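/- Let Γ ⊂ P^n be a nondegenerate finite subscheme of degree d over an algebraically closed field of characteristic 0 such that ⌈(d−n−1)/(t(Γ)+1)⌉ + 3 ≤ reg(Γ) ≤ ⌈(d−n−1)/t(Γ)⌉ + 2. Then there exists a unique t(Γ)-dimensional linear subspace Λ of P^n such that (i) Γ ∩ Λ is nondegenerate and in linearly general position as a subscheme of Λ, and (ii) reg(Γ ∩ Λ) = reg(Γ). -/

import Mathlib

open MvPolynomial Filter
open scoped Classical

attribute [local instance] MvPolynomial.gradedAlgebra

noncomputable section

variable {K : Type} [Field K] {n : ℕ}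

/-- The Hilbert function, in degree `m`, of the quotient of the homogeneous
coordinate ring of `ℙ^n_K` by the ideal `I`. -/
def hilbF (I : Ideal (MvPolynomial (Fin (n+1)) K)) (m : ℕ) : ℕ :=
  Module.finrank K
    ((MvPolynomial.homogeneousSubmodule (Fin (n+1)) K m).map
      (Ideal.Quotient.mkₐ K I).toLinearMap)

/-- The irrelevant maximal ideal `(x_0, …, x_n)`. -/
def irrelevantIdeal (K : Type) [Field K] (n : ℕ) : Ideal (MvPolynomial (Fin (n+1)) K) :=
  Ideal.span (Set.range MvPolynomial.X)

/-- Saturation of a homogeneous ideal with respect to the irrelevant ideal. -/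
def saturate (I : Ideal (MvPolynomial (Fin (n+1)) K)) : Ideal (MvPolynomial (Fin (n+1)) K) :=
  ⨆ k : ℕ, Submodule.colon I ((irrelevantIdeal K n ^ k : Ideal (MvPolynomial (Fin (n+1)) K)) : Submodule (MvPolynomial (Fin (n+1)) K) (MvPolynomial (Fin (n+1)) K))

/-- `I` is the (saturated, homogeneous) ideal of a nonempty finite closed subscheme of
`ℙ^n`, i.e. its Hilbert function is eventually a positive constant. -/
structure IsFiniteSubscheme (I : Ideal (MvPolynomial (Fin (n+1)) K)) : Prop where
  homog : Ideal.IsHomogeneous (MvPolynomial.homogeneousSubmodule (Fin (n+1)) K) I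
  saturated : saturate I = I
  finite : ∃ d : ℕ, 0 < d ∧ ∀ᶠ m : ℕ in atTop, hilbF I m = d

/-- The degree (length) of the finite scheme with ideal `I` : the eventual value of
its Hilbert function. -/
def schemeDeg (I : Ideal (MvPolynomial (Fin (n+1)) K)) : ℕ :=
  if h : ∃ d : ℕ, ∀ᶠ m : ℕ in atTop, hilbF I m = d then h.choose else 0

/-- The Castelnuovo–Mumford regularity of the finite scheme with ideal `I` : the least
`p ≥ 1` such that the scheme is `(p-1)`-normal (for a finite scheme, `p`-regularity is
equivalent to `(p-1)`-normality). -/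
def schemeReg (I : Ideal (MvPolynomial (Fin (n+1)) K)) : ℕ :=
  sInf {p : ℕ | 1 ≤ p ∧ ∀ m : ℕ, p - 1 ≤ m → hilbF I m = schemeDeg I}

/-- `h¹(ℙ^n, I_Γ(q))` for a finite scheme `Γ` and `q ≥ 0`: the failure of `q`-normality,
`deg Γ - h_Γ(q)`. -/
def h1F (I : Ideal (MvPolynomial (Fin (n+1)) K)) (q : ℕ) : ℕ :=
  schemeDeg I - hilbF I q

/-- `J` is the ideal of a `t`-dimensional linear subspace of `ℙ^n`: it is generated by a
space of linear forms of codimension... i.e. of `K`-dimension `n - t`. -/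
def IsLinearSubspace (J : Ideal (MvPolynomial (Fin (n+1)) K)) (t : ℕ) : Prop :=
  ∃ W : Submodule K (MvPolynomial (Fin (n+1)) K),
    W ≤ MvPolynomial.homogeneousSubmodule (Fin (n+1)) K 1 ∧
    Module.finrank K W + t = n ∧
    J = Ideal.span (W : Set (MvPolynomial (Fin (n+1)) K))

/-- The ideal of the scheme-theoretic intersection (defined by the sum of the ideal
sheaves): the saturation of `I + J`. -/
def interIdeal (I J : Ideal (MvPolynomial (Fin (n+1)) K)) : Ideal (MvPolynomial (Fin (n+1)) K) :=
  saturate (I ⊔ J)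

/-- The residual scheme `Γ : V`, where `V` is the hypersurface `{f = 0}`, is defined by
the colon ideal `(I_Γ : f)`. -/
def residualIdeal (I : Ideal (MvPolynomial (Fin (n+1)) K)) (f : MvPolynomial (Fin (n+1)) K) :
    Ideal (MvPolynomial (Fin (n+1)) K) :=
  Submodule.colon I (Ideal.span {f})

/-- `Γ` admits a `(t+2)`-secant `t`-plane. -/
def HasSecantPlane (I : Ideal (MvPolynomial (Fin (n+1)) K)) (t : ℕ) : Prop :=
  ∃ J : Ideal (MvPolynomial (Fin (n+1)) K),
    IsLinearSubspace J t ∧ t + 2 ≤ schemeDeg (interIdeal I J)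

/-- `t(Γ)`: the smallest `t` such that `Γ` admits a `(t+2)`-secant `t`-plane. -/
def tInv (I : Ideal (MvPolynomial (Fin (n+1)) K)) : ℕ :=
  sInf {t : ℕ | HasSecantPlane I t}

/-- `Γ` is in linearly general position if `t(Γ) = n`. -/
def InLinGenPos (I : Ideal (MvPolynomial (Fin (n+1)) K)) : Prop :=
  tInv I = n

/-- `Γ ⊆ ℙ^n` is nondegenerate: `I(Γ)` contains no nonzero linear form. -/
def NondegenerateScheme (I : Ideal (MvPolynomial (Fin (n+1)) K)) : Prop :=
  Submodule.restrictScalars K I ⊓ MvPolynomial.homogeneousSubmodule (Fin (n+1)) K 1 = ⊥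

/-- The (projective) dimension of the linear span `⟨Γ⟩` of the scheme with ideal `I`:
`n` minus the number of independent linear forms in `I`. -/
def spanDim (I : Ideal (MvPolynomial (Fin (n+1)) K)) : ℕ :=
  n - Module.finrank K
    ↥(Submodule.restrictScalars K I ⊓ MvPolynomial.homogeneousSubmodule (Fin (n+1)) K 1)

/-- `Γ ∩ Λ` is nondegenerate as a subscheme of the `t`-plane `Λ`: it is contained in no
`(t-1)`-dimensional linear subspace of `Λ`. -/
def NondegenerateIn (I Λ : Ideal (MvPolynomial (Fin (n+1)) K)) (t : ℕ) : Prop :=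
  ∀ J : Ideal (MvPolynomial (Fin (n+1)) K),
    IsLinearSubspace J (t - 1) → Λ ≤ J → ¬ J ≤ interIdeal I Λ

/-- `Γ ∩ Λ` is in linearly general position as a subscheme of the `t`-plane `Λ`: it has
no `(s+2)`-secant `s`-plane inside `Λ` for any `s < t`. -/
def InLinGenPosIn (I Λ : Ideal (MvPolynomial (Fin (n+1)) K)) (t : ℕ) : Prop :=
  ∀ s : ℕ, s < t → ∀ J : Ideal (MvPolynomial (Fin (n+1)) K),
    IsLinearSubspace J s → Λ ≤ J → schemeDeg (interIdeal I J) ≤ s + 1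

/-- `J` is the (saturated) homogeneous ideal of a rational normal curve of degree `t`
in `ℙ^n` : the curve is the image of `ℙ^1` under a parametrization by a basis-spanning
family of binary forms of degree `t`, and `J` is the vanishing ideal of (the affine cone
over) this image. -/
def IsRNC (t : ℕ) (J : Ideal (MvPolynomial (Fin (n+1)) K)) : Prop :=
  ∃ p : Fin (n+1) → MvPolynomial (Fin 2) K,
    (∀ i, (p i).IsHomogeneous t) ∧
    Submodule.span K (Set.range p) = MvPolynomial.homogeneousSubmodule (Fin 2) K t ∧
    J = ⨅ x : Fin 2 → K,
      RingHom.ker (MvPolynomial.eval (fun i => MvPolynomial.eval x (p i)) :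
        MvPolynomial (Fin (n+1)) K →+* K)

/-- `ρ(Γ)`: the maximal length of the intersection of `Γ` with a rational normal curve
(of degree `n`) in `ℙ^n`. -/
def rhoInv (I : Ideal (MvPolynomial (Fin (n+1)) K)) : ℕ :=
  sSup {e : ℕ | ∃ J : Ideal (MvPolynomial (Fin (n+1)) K),
    IsRNC n J ∧ e = schemeDeg (interIdeal I J)}

/-- The (saturated homogeneous) vanishing ideal of a point of `ℙ^n`. -/
def pointIdeal (P : Projectivization K (Fin (n+1) → K)) : Ideal (MvPolynomial (Fin (n+1)) K) :=
  ⨅ c : K, RingHom.ker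
    (MvPolynomial.eval (c • P.rep) : MvPolynomial (Fin (n+1)) K →+* K)

/-- The vanishing ideal of a finite set of points of `ℙ^n`. -/
def idealOfFinset (S : Finset (Projectivization K (Fin (n+1) → K))) :
    Ideal (MvPolynomial (Fin (n+1)) K) :=
  ⨅ P ∈ S, pointIdeal P

/-- A finite set of points of `ℙ^n` is in uniform position if every subset `Y` has
Hilbert function `h_Y(ℓ) = min {|Y|, h_Γ(ℓ)}`. -/
def UniformPosition (S : Finset (Projectivization K (Fin (n+1) → K))) : Prop :=
  ∀ Y ⊆ S, ∀ ℓ : ℕ, hilbF (idealOfFinset Y) ℓ = min Y.card (hilbF (idealOfFinset S) ℓ)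

end

section FiniteAlgebra

open Module

variable {K A : Type*} [Field K] [CommRing A] [Algebra K A]

theorem sup_eq_top_of_residual {U : Submodule K A} {u : A} (hu : u ∈ U) {k : ℕ} {𝔞 : Ideal A}
    (h₁ : U ^ k ⊔ (Submodule.comap (LinearMap.mulLeft A u) 𝔞).restrictScalars K = ⊤)
    (h₂ : U ^ (k + 1) ⊔ (𝔞 ⊔ Ideal.span {u}).restrictScalars K = ⊤) :
    U ^ (k + 1) ⊔ 𝔞.restrictScalars K = ⊤ := by
  rw [eq_top_iff]
  intro a _
  have ha : a ∈ U ^ (k + 1) ⊔ (𝔞 ⊔ Ideal.span {u}).restrictScalars K := h₂ ▸ Submodule.mem_top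
  obtain ⟨x, hx, y, hy, rfl⟩ := Submodule.mem_sup.1 ha
  obtain ⟨b, hb, z, hz, rfl⟩ := Submodule.mem_sup.1 (show y ∈ 𝔞 ⊔ Ideal.span {u} from hy)
  obtain ⟨c, rfl⟩ := Ideal.mem_span_singleton'.1 hz
  have hc : c ∈ U ^ k ⊔ (Submodule.comap (LinearMap.mulLeft A u) 𝔞).restrictScalars K :=
    h₁ ▸ Submodule.mem_top
  obtain ⟨v, hv, e, he, rfl⟩ := Submodule.mem_sup.1 hc
  have he' : u * e ∈ 𝔞 := he
  refine Submodule.mem_sup.2 ⟨x + v * u, add_mem hx (pow_succ U k ▸ Submodule.mul_mem_mul hv hu),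
    b + u * e, add_mem hb he', by ring⟩

theorem pow_mono_of_one_mem {U : Submodule K A} (h1 : (1 : A) ∈ U) : Monotone (fun k => U ^ k) :=
  pow_right_monotone (Submodule.one_le.2 h1)

variable [FiniteDimensional K A]

theorem finrank_map_add_finrank_inf_ker {M : Type*} [AddCommGroup M] [Module K M]
    (f : A →ₗ[K] M) (p : Submodule K A) :
    finrank K (p.map f) + finrank K (p ⊓ LinearMap.ker f : Submodule K A) = finrank K p := by
  have h := LinearMap.finrank_range_add_finrank_ker (f.domRestrict p)
  rw [LinearMap.range_domRestrict] at h
  have e : finrank K (LinearMap.ker (f.domRestrict p)) =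
      finrank K (p ⊓ LinearMap.ker f : Submodule K A) := by
    rw [LinearMap.ker_domRestrict, ← Submodule.finrank_map_subtype_eq p,
      Submodule.map_comap_subtype]
  omega

theorem finrank_residual (𝔞 : Ideal A) (u : A) :
    finrank K A + finrank K (𝔞.restrictScalars K) =
      finrank K ((Submodule.comap (LinearMap.mulLeft A u) 𝔞).restrictScalars K) +
      finrank K ((𝔞 ⊔ Ideal.span {u}).restrictScalars K) := by
  let f : A →ₗ[K] A := LinearMap.mulLeft K u
  have hker : (Submodule.comap (LinearMap.mulLeft A u) 𝔞).restrictScalars K =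
      LinearMap.ker ((𝔞.restrictScalars K).mkQ ∘ₗ f) := by
    ext x; simp [f]
  have hr : LinearMap.range ((𝔞.restrictScalars K).mkQ ∘ₗ f) =
      Submodule.map (𝔞.restrictScalars K).mkQ ((𝔞 ⊔ Ideal.span {u}).restrictScalars K) := by
    apply le_antisymm
    · rintro _ ⟨x, rfl⟩
      exact ⟨u * x, (show u * x ∈ 𝔞 ⊔ Ideal.span {u} from
        Ideal.mul_mem_right _ _ (Submodule.mem_sup_right (Ideal.mem_span_singleton_self u))), rfl⟩
    · rintro _ ⟨y, hy, rfl⟩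
      obtain ⟨b, hb, z, hz, rfl⟩ := Submodule.mem_sup.1 (show y ∈ 𝔞 ⊔ Ideal.span {u} from hy)
      obtain ⟨c, rfl⟩ := Ideal.mem_span_singleton'.1 hz
      refine ⟨c, ?_⟩
      have : (𝔞.restrictScalars K).mkQ b = 0 := by simpa using hb
      rw [map_add, this, zero_add]
      simp [f, mul_comm]
  have e1 := LinearMap.finrank_range_add_finrank_ker ((𝔞.restrictScalars K).mkQ ∘ₗ f)
  have e2 := finrank_map_add_finrank_inf_ker (𝔞.restrictScalars K).mkQ
    ((𝔞 ⊔ Ideal.span {u}).restrictScalars K)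
  have hle : 𝔞.restrictScalars K ≤ (𝔞 ⊔ Ideal.span {u}).restrictScalars K :=
    fun x hx => Submodule.mem_sup_left (show x ∈ 𝔞 from hx)
  rw [Submodule.ker_mkQ, inf_eq_right.2 hle] at e2
  rw [hker]
  rw [hr] at e1
  omega

/-- Every linear subspace `W ≤ U` of codimension at most `t` in `U` generates an ideal of
colength at most its codimension. -/
def SecantFree (U : Submodule K A) (t : ℕ) : Prop :=
  ∀ W : Submodule K A, W ≤ U → finrank K U ≤ finrank K W + t →
    finrank K A + finrank K W ≤
      finrank K ((Ideal.span (W : Set A)).restrictScalars K) + finrank K U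

theorem eq_top_of_finrank_le {P : Submodule K A} (h : finrank K A ≤ finrank K P) : P = ⊤ :=
  Submodule.eq_top_of_finrank_eq (le_antisymm (Submodule.finrank_le P) h)

theorem SecantFree.sup_eq_top {U : Submodule K A} {t : ℕ} (hU : SecantFree U t) {𝔞 : Ideal A}
    (h : finrank K U ≤ finrank K (U ⊓ 𝔞.restrictScalars K : Submodule K A) + t) :
    U ⊔ 𝔞.restrictScalars K = ⊤ := by
  apply eq_top_of_finrank_le
  have h1 := hU _ inf_le_left h
  have h2 : finrank K ((Ideal.span ((U ⊓ 𝔞.restrictScalars K : Submodule K A) : Set A)).restrictScalars K) ≤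
      finrank K (𝔞.restrictScalars K) := by
    apply Submodule.finrank_mono
    intro x hx
    have : Ideal.span ((U ⊓ 𝔞.restrictScalars K : Submodule K A) : Set A) ≤ 𝔞 :=
      Ideal.span_le.2 fun y hy => hy.2
    exact this hx
  have h3 := Submodule.finrank_sup_add_finrank_inf_eq U (𝔞.restrictScalars K)
  omega

omit [FiniteDimensional K A] in
theorem sup_eq_top_of_le {U P Q : Submodule K A} (h : U ⊔ P = ⊤) (hPQ : P ≤ Q) : U ⊔ Q = ⊤ :=
  top_le_iff.1 (h ▸ sup_le_sup_left hPQ U)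

omit [FiniteDimensional K A] in
theorem pow_sup_eq_top_mono {U P : Submodule K A} (h1 : (1 : A) ∈ U) {i j : ℕ} (hij : i ≤ j)
    (h : U ^ i ⊔ P = ⊤) : U ^ j ⊔ P = ⊤ :=
  top_le_iff.1 (h ▸ sup_le_sup_right (pow_mono_of_one_mem h1 hij) P)

/-- A minimal ideal above `𝔞` meeting `W` outside `𝔞` is cut out by a single element of `W`
modulo `𝔞`, up to scalars. -/
theorem exists_mem_inf_sup_span_le [IsAlgClosed K] {W : Submodule K A} {𝔞 : Ideal A}
    (h : ¬ W ≤ 𝔞.restrictScalars K) :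
    ∃ u ∈ W, u ∉ 𝔞 ∧ W ⊓ (𝔞 ⊔ Ideal.span {u}).restrictScalars K ≤
      𝔞.restrictScalars K ⊔ Submodule.span K {u} := by
  have : IsArtinianRing A := IsArtinianRing.of_finite K A
  let T : Set (Ideal A) := {𝔠 | ∃ u ∈ W, u ∉ 𝔞 ∧ 𝔠 = 𝔞 ⊔ Ideal.span {u}}
  obtain ⟨w, hw, hwa⟩ := SetLike.not_le_iff_exists.1 h
  obtain ⟨_, ⟨u, hu, hua, rfl⟩, hmin⟩ := WellFounded.has_min
    (wellFounded_lt : WellFounded ((· < ·) : Ideal A → Ideal A → Prop)) T ⟨_, w, hw, hwa, rfl⟩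
  refine ⟨u, hu, hua, ?_⟩
  rintro v ⟨hvW, hv⟩
  obtain ⟨b, hb, z, hz, rfl⟩ := Submodule.mem_sup.1 (show v ∈ 𝔞 ⊔ Ideal.span {u} from hv)
  obtain ⟨x, rfl⟩ := Ideal.mem_span_singleton'.1 hz
  let 𝔯 : Ideal A := Submodule.comap (LinearMap.mulLeft A u) 𝔞
  have hr : ∀ y, y ∈ 𝔯 ↔ u * y ∈ 𝔞 := fun y => Iff.rfl
  have hnt : Nontrivial (A ⧸ 𝔯) := by
    refine Ideal.Quotient.nontrivial_iff.2 fun htop => hua ?_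
    have := (hr 1).1 (htop ▸ Submodule.mem_top)
    simpa using this
  have : FiniteDimensional K (A ⧸ 𝔯) :=
    Module.Finite.of_surjective (Ideal.Quotient.mkₐ K 𝔯).toLinearMap Ideal.Quotient.mk_surjective
  obtain ⟨c, hc⟩ := spectrum.nonempty_of_isAlgClosed_of_finiteDimensional K
    (Ideal.Quotient.mk 𝔯 x)
  rw [spectrum.mem_iff] at hc
  have hmem : b + x * u - c • u ∈ 𝔞 := by
    by_contra hcon
    apply hmin _ ⟨_, sub_mem hvW (W.smul_mem c hu), hcon, rfl⟩
    refine lt_of_le_of_ne (sup_le le_sup_left ?_) fun heq => hc ?_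
    · rw [Ideal.span_singleton_le_iff_mem]
      refine Submodule.mem_sup.2 ⟨b, hb, (x - algebraMap K A c) * u,
        Ideal.mul_mem_left _ _ (Ideal.mem_span_singleton_self u), ?_⟩
      rw [Algebra.smul_def]; ring
    · have hu' : u ∈ 𝔞 ⊔ Ideal.span {b + x * u - c • u} :=
        heq ▸ Submodule.mem_sup_right (Ideal.mem_span_singleton_self u)
      obtain ⟨b', hb', z', hz', hsum⟩ := Submodule.mem_sup.1 hu'
      obtain ⟨y, rfl⟩ := Ideal.mem_span_singleton'.1 hz'
      have : (algebraMap K A c - x) * (-y) - 1 ∈ 𝔯 := by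
        rw [hr]
        have : u * ((algebraMap K A c - x) * (-y) - 1) = -(b' + y * b) := by
          rw [Algebra.smul_def] at hsum
          linear_combination hsum
        rw [this]
        exact neg_mem (add_mem hb' (Ideal.mul_mem_left _ _ hb))
      refine IsUnit.of_mul_eq_one (Ideal.Quotient.mk 𝔯 (-y)) ?_
      rw [← sub_eq_zero]
      have h0 := Ideal.Quotient.eq_zero_iff_mem.2 this
      rw [map_sub, map_mul, map_sub, map_one] at h0
      exact h0
  exact Submodule.mem_sup.2 ⟨_, hmem, c • u, Submodule.smul_mem _ _
    (Submodule.mem_span_singleton_self u), by ring⟩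

/-- A subspace `W` of an ideal `𝔟` contains an element `u` generating modulo `𝔞` an ideal whose
colength exceeds that of `𝔟` by at least `dim W / (W ⊓ 𝔞) - 1`. -/
theorem exists_mem_finrank_add_le [IsAlgClosed K] {W : Submodule K A} {𝔞 𝔟 : Ideal A}
    (h : ¬ W ≤ 𝔞.restrictScalars K) (hab : 𝔞 ≤ 𝔟) (hWb : W ≤ 𝔟.restrictScalars K) :
    ∃ u ∈ W, u ∉ 𝔞 ∧ finrank K ((𝔞 ⊔ Ideal.span {u}).restrictScalars K) + finrank K W ≤
      finrank K (𝔟.restrictScalars K) +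
        finrank K (W ⊓ 𝔞.restrictScalars K : Submodule K A) + 1 := by
  obtain ⟨u, hu, hua, hle⟩ := exists_mem_inf_sup_span_le h
  refine ⟨u, hu, hua, ?_⟩
  set C := (𝔞 ⊔ Ideal.span {u}).restrictScalars K with hC
  have h1 := Submodule.finrank_sup_add_finrank_inf_eq W C
  have h2 : finrank K (W ⊔ C : Submodule K A) ≤ finrank K (𝔟.restrictScalars K) := by
    refine Submodule.finrank_mono (sup_le hWb ?_)
    have : 𝔞 ⊔ Ideal.span {u} ≤ 𝔟 := sup_le hab ((Ideal.span_singleton_le_iff_mem _).2 (hWb hu))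
    exact this
  have h3 : W ⊓ C ≤ (W ⊓ 𝔞.restrictScalars K) ⊔ Submodule.span K {u} := by
    rintro v ⟨hvW, hvC⟩
    obtain ⟨b, hb, z, hz, rfl⟩ := Submodule.mem_sup.1 (hle ⟨hvW, hvC⟩)
    have hzW : z ∈ W := (Submodule.span_singleton_le_iff_mem _ _).2 hu hz
    exact Submodule.mem_sup.2 ⟨b, ⟨(Submodule.add_mem_iff_left W hzW).1 hvW, hb⟩, z, hz, rfl⟩
  have h4 := Submodule.finrank_mono h3
  have h5 := Submodule.finrank_add_le_finrank_add_finrank (W ⊓ 𝔞.restrictScalars K)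
    (Submodule.span K {u})
  have h6 : finrank K (Submodule.span K {u}) ≤ 1 := by
    simpa using finrank_span_le_card (R := K) ({u} : Set A)
  omega

theorem SecantFree.pow_sup_eq_top [IsAlgClosed K] {U : Submodule K A} (h1 : (1 : A) ∈ U) {t : ℕ}
    (hU : SecantFree U t) (k : ℕ) (𝔞 : Ideal A)
    (h : finrank K A ≤ finrank K (U ⊔ 𝔞.restrictScalars K : Submodule K A) + t * k) :
    U ^ (k + 1) ⊔ 𝔞.restrictScalars K = ⊤ := by
  induction k generalizing 𝔞 with
  | zero => rw [zero_add, pow_one]; exact eq_top_of_finrank_le (by simpa using h)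
  | succ k ih =>
    have : IsNoetherianRing A := IsNoetherianRing.of_finite K A
    induction 𝔞 using WellFoundedGT.induction with
    | ind 𝔞 ih' =>
    by_cases hUa : U ≤ 𝔞.restrictScalars K
    · have : 𝔞 = ⊤ := (Ideal.eq_top_iff_one _).2 (hUa h1)
      simp [this]
    obtain ⟨u, hu, hua, hlen⟩ := exists_mem_finrank_add_le hUa (le_top : 𝔞 ≤ ⊤) (by simp)
    have hsup := finrank_residual (K := K) 𝔞 u
    have hUA := Submodule.finrank_sup_add_finrank_inf_eq U (𝔞.restrictScalars K)
    have hr := Submodule.finrank_sup_add_finrank_inf_eq U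
      ((Submodule.comap (LinearMap.mulLeft A u) 𝔞).restrictScalars K)
    have htop : finrank K ((⊤ : Ideal A).restrictScalars K) = finrank K A := by
      rw [Submodule.restrictScalars_top, finrank_top]
    refine sup_eq_top_of_residual hu ?_ ?_
    · by_cases hc : finrank K U ≤ finrank K (U ⊓
        (Submodule.comap (LinearMap.mulLeft A u) 𝔞).restrictScalars K : Submodule K A) + t
      · exact pow_sup_eq_top_mono h1 (Nat.le_add_left 1 k) (by rw [pow_one]; exact hU.sup_eq_top hc)
      · apply ih
        rw [mul_add] at h
        omega
    · refine ih' _ (lt_of_le_of_ne le_sup_left fun heq => hua ?_) (h.trans ?_)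
      · rw [heq]; exact Submodule.mem_sup_right (Ideal.mem_span_singleton_self u)
      · have hle : 𝔞.restrictScalars K ≤ (𝔞 ⊔ Ideal.span {u}).restrictScalars K :=
          (show 𝔞 ≤ 𝔞 ⊔ Ideal.span {u} from le_sup_left)
        exact Nat.add_le_add_right (Submodule.finrank_mono (sup_le_sup_left hle _)) _

/-- If `𝔞` has a small defect and is not cut out by degree `k + 1`, the failure is already visible
on a linear section of codimension `t + 1` in `U`. -/
theorem SecantFree.exists_pow_sup_ne_top [IsAlgClosed K] {U : Submodule K A} (h1 : (1 : A) ∈ U)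
    {t : ℕ} (ht : 1 ≤ t) (hU : SecantFree U t) (k : ℕ) (𝔞 : Ideal A)
    (h : finrank K A ≤ finrank K (U ⊔ 𝔞.restrictScalars K : Submodule K A) + (t + 1) * k)
    (hne : U ^ (k + 1) ⊔ 𝔞.restrictScalars K ≠ ⊤) :
    ∃ W : Submodule K A, W ≤ U ∧ finrank K U = finrank K W + (t + 1) ∧
      U ^ (k + 1) ⊔ (𝔞 ⊔ Ideal.span (W : Set A)).restrictScalars K ≠ ⊤ := by
  induction k generalizing 𝔞 with
  | zero =>
    rw [zero_add, pow_one] at hne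
    exact absurd (eq_top_of_finrank_le (by simpa using h)) hne
  | succ k ih =>
    have : IsNoetherianRing A := IsNoetherianRing.of_finite K A
    induction 𝔞 using WellFoundedGT.induction with
    | ind 𝔞 ih' =>
    by_cases hgt : ∃ 𝔟, 𝔞 < 𝔟 ∧ U ^ (k + 1 + 1) ⊔ 𝔟.restrictScalars K ≠ ⊤
    · obtain ⟨𝔟, hab, hb⟩ := hgt
      have hle : 𝔞.restrictScalars K ≤ 𝔟.restrictScalars K := hab.le
      obtain ⟨W, hWU, hW, hn⟩ := ih' 𝔟 hab
        (h.trans (Nat.add_le_add_right (Submodule.finrank_mono (sup_le_sup_left hle _)) _)) hb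
      refine ⟨W, hWU, hW, fun heq => hn (sup_eq_top_of_le heq ?_)⟩
      exact (show 𝔞 ⊔ Ideal.span (W : Set A) ≤ 𝔟 ⊔ Ideal.span (W : Set A) from
        sup_le_sup_right hab.le _)
    push Not at hgt
    have hlt : ∀ {u : A}, u ∉ 𝔞 → 𝔞 < 𝔞 ⊔ Ideal.span {u} := fun {u} hu =>
      lt_of_le_of_ne le_sup_left fun heq => hu
        (heq ▸ Submodule.mem_sup_right (Ideal.mem_span_singleton_self u))
    have hbig : finrank K (U ⊓ 𝔞.restrictScalars K : Submodule K A) + t < finrank K U := by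
      by_contra! hc
      exact hne (pow_sup_eq_top_mono h1 (Nat.le_add_left 1 _)
        (by rw [pow_one]; exact hU.sup_eq_top hc))
    have hUA := Submodule.finrank_sup_add_finrank_inf_eq U (𝔞.restrictScalars K)
    have htop : finrank K ((⊤ : Ideal A).restrictScalars K) = finrank K A := by
      rw [Submodule.restrictScalars_top, finrank_top]
    by_cases heq : finrank K U =
        finrank K (U ⊓ 𝔞.restrictScalars K : Submodule K A) + (t + 1)
    · refine ⟨_, inf_le_left, heq, fun hcon => hne (sup_eq_top_of_le hcon ?_)⟩
      exact (show 𝔞 ⊔ Ideal.span _ ≤ 𝔞 from sup_le le_rfl (Ideal.span_le.2 fun y hy => hy.2))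
    have hUa : ¬ U ≤ 𝔞.restrictScalars K := fun hle => by
      rw [inf_eq_left.2 hle] at hbig; omega
    obtain ⟨W, hWU, hW, hWn⟩ : ∃ W : Submodule K A, W ≤ U ∧
        finrank K U = finrank K W + (t + 1) ∧
        U ^ (k + 1) ⊔ (𝔞 ⊔ Ideal.span (W : Set A)).restrictScalars K ≠ ⊤ := by
      obtain ⟨u, hu, hua, hlen⟩ := exists_mem_finrank_add_le hUa (le_top : 𝔞 ≤ ⊤) (by simp)
      have hres := finrank_residual (K := K) 𝔞 u
      set 𝔯 : Ideal A := Submodule.comap (LinearMap.mulLeft A u) 𝔞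
      have hr := Submodule.finrank_sup_add_finrank_inf_eq U (𝔯.restrictScalars K)
      have har : 𝔞 ≤ 𝔯 := fun x hx => (show u * x ∈ 𝔞 from Ideal.mul_mem_left _ _ hx)
      have hrn : U ^ (k + 1) ⊔ 𝔯.restrictScalars K ≠ ⊤ := fun hc =>
        hne (sup_eq_top_of_residual hu hc (hgt _ (hlt hua)))
      have hbig' : finrank K (U ⊓ 𝔯.restrictScalars K : Submodule K A) + t < finrank K U := by
        by_contra! hc
        exact hrn (pow_sup_eq_top_mono h1 (Nat.le_add_left 1 _)
          (by rw [pow_one]; exact hU.sup_eq_top hc))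
      by_cases heq' : finrank K U =
          finrank K (U ⊓ 𝔯.restrictScalars K : Submodule K A) + (t + 1)
      · refine ⟨_, inf_le_left, heq', fun hcon => hrn (sup_eq_top_of_le hcon ?_)⟩
        exact (show 𝔞 ⊔ Ideal.span _ ≤ 𝔯 from sup_le har (Ideal.span_le.2 fun y hy => hy.2))
      · obtain ⟨W, hWU, hW, hn⟩ := ih 𝔯 (by rw [mul_add] at h; omega) hrn
        refine ⟨W, hWU, hW, fun hcon => hn (sup_eq_top_of_le hcon ?_)⟩
        exact (show 𝔞 ⊔ Ideal.span (W : Set A) ≤ 𝔯 ⊔ Ideal.span (W : Set A) from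
          sup_le_sup_right har _)
    exfalso
    obtain ⟨𝔟, h𝔟⟩ : ∃ 𝔟 : Ideal A, 𝔟 = 𝔞 ⊔ Ideal.span (W : Set A) := ⟨_, rfl⟩
    rw [← h𝔟] at hWn
    have hWb : W ≤ 𝔟.restrictScalars K := fun x hx =>
      (show x ∈ 𝔟 from h𝔟 ▸ Submodule.mem_sup_right (Ideal.subset_span hx))
    have hb1 : finrank K (U ⊔ 𝔟.restrictScalars K : Submodule K A) + t * k < finrank K A := by
      by_contra! hc
      exact hWn (hU.pow_sup_eq_top h1 k 𝔟 hc)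
    have hb2 : finrank K (U ⊓ 𝔟.restrictScalars K : Submodule K A) + t < finrank K U := by
      by_contra! hc
      exact hWn (pow_sup_eq_top_mono h1 (Nat.le_add_left 1 _)
        (by rw [pow_one]; exact hU.sup_eq_top hc))
    have hUb := Submodule.finrank_sup_add_finrank_inf_eq U (𝔟.restrictScalars K)
    have hWa : ¬ W ≤ 𝔞.restrictScalars K := fun hle => by
      have := Submodule.finrank_mono (le_inf hWU hle)
      omega
    obtain ⟨u, hu, hua, hlen⟩ := exists_mem_finrank_add_le hWa (h𝔟 ▸ le_sup_left) hWb
    have hWUa : finrank K (W ⊓ 𝔞.restrictScalars K : Submodule K A) ≤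
        finrank K (U ⊓ 𝔞.restrictScalars K : Submodule K A) :=
      Submodule.finrank_mono (inf_le_inf_right _ hWU)
    have hres := finrank_residual (K := K) 𝔞 u
    refine hne (sup_eq_top_of_residual (hWU hu) ?_ (hgt _ (hlt hua)))
    set 𝔯 : Ideal A := Submodule.comap (LinearMap.mulLeft A u) 𝔞
    have hr := Submodule.finrank_sup_add_finrank_inf_eq U (𝔯.restrictScalars K)
    by_cases hc : finrank K U ≤ finrank K (U ⊓ 𝔯.restrictScalars K : Submodule K A) + t
    · exact pow_sup_eq_top_mono h1 (Nat.le_add_left 1 k) (by rw [pow_one]; exact hU.sup_eq_top hc)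
    · apply hU.pow_sup_eq_top h1
      have hk : k ≤ t * k := Nat.le_mul_of_pos_left k ht
      have e : (t + 1) * (k + 1) = t * k + k + t + 1 := by ring
      omega

/-- A linear section of codimension `t + 1` in `U` that is not cut out by degree `k + 1` is
unique. -/
theorem SecantFree.eq_of_pow_sup_ne_top [IsAlgClosed K] {U : Submodule K A} (h1 : (1 : A) ∈ U)
    {t : ℕ} (ht : 1 ≤ t) (hU : SecantFree U t) {k : ℕ}
    (h : finrank K A ≤ finrank K U + (t + 1) * k) {W₁ W₂ : Submodule K A}
    (hW₁ : W₁ ≤ U) (hW₂ : W₂ ≤ U) (hd₁ : finrank K U = finrank K W₁ + (t + 1))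
    (hd₂ : finrank K U = finrank K W₂ + (t + 1))
    (hn₁ : U ^ (k + 1) ⊔ (Ideal.span (W₁ : Set A)).restrictScalars K ≠ ⊤)
    (hn₂ : U ^ (k + 1) ⊔ (Ideal.span (W₂ : Set A)).restrictScalars K ≠ ⊤) : W₁ = W₂ := by
  by_contra hne
  have key : ∀ W : Submodule K A, W ≤ U → finrank K U = finrank K W + (t + 1) →
      U ^ (k + 1) ⊔ (Ideal.span (W : Set A)).restrictScalars K ≠ ⊤ →
      U ⊓ (Ideal.span (W : Set A)).restrictScalars K = W ∧
      finrank K ((Ideal.span (W : Set A)).restrictScalars K) + t * k + (t + 1) < finrank K A := by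
    intro W hWU hd hn
    have hb1 : finrank K (U ⊔ (Ideal.span (W : Set A)).restrictScalars K : Submodule K A) + t * k <
        finrank K A := by
      by_contra! hc
      exact hn (hU.pow_sup_eq_top h1 k _ hc)
    have hb2 : finrank K (U ⊓ (Ideal.span (W : Set A)).restrictScalars K : Submodule K A) + t <
        finrank K U := by
      by_contra! hc
      exact hn (pow_sup_eq_top_mono h1 (Nat.le_add_left 1 _)
        (by rw [pow_one]; exact hU.sup_eq_top hc))
    have hUb := Submodule.finrank_sup_add_finrank_inf_eq U
      ((Ideal.span (W : Set A)).restrictScalars K)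
    have hle : W ≤ U ⊓ (Ideal.span (W : Set A)).restrictScalars K :=
      le_inf hWU fun x hx => Ideal.subset_span hx
    have hmono := Submodule.finrank_mono hle
    exact ⟨(Submodule.eq_of_le_of_finrank_le hle (by omega)).symm, by omega⟩
  obtain ⟨hi₁, hr₁⟩ := key W₁ hW₁ hd₁ hn₁
  obtain ⟨hi₂, hr₂⟩ := key W₂ hW₂ hd₂ hn₂
  set B₁ := (Ideal.span (W₁ : Set A)).restrictScalars K with hB₁
  set B₂ := (Ideal.span (W₂ : Set A)).restrictScalars K with hB₂
  have hWs := Submodule.finrank_sup_add_finrank_inf_eq W₁ W₂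
  have hBs := Submodule.finrank_sup_add_finrank_inf_eq B₁ B₂
  have hUB := Submodule.finrank_sup_add_finrank_inf_eq U (B₁ ⊓ B₂)
  have hUBi : U ⊓ (B₁ ⊓ B₂) = W₁ ⊓ W₂ := by
    rw [← hi₁, ← hi₂]; ext x; simp only [Submodule.mem_inf]; tauto
  rw [hUBi] at hUB
  have hlt : finrank K W₁ < finrank K (W₁ ⊔ W₂ : Submodule K A) := by
    apply Submodule.finrank_lt_finrank_of_lt
    refine lt_of_le_of_ne le_sup_left fun heq => hne ?_
    exact (Submodule.eq_of_le_of_finrank_le (heq ▸ le_sup_right : W₂ ≤ W₁) (by omega)).symm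
  have hsum := hU (W₁ ⊔ W₂) (sup_le hW₁ hW₂) (by omega)
  have hspan : (Ideal.span ((W₁ ⊔ W₂ : Submodule K A) : Set A)).restrictScalars K ≤ B₁ ⊔ B₂ := by
    rw [hB₁, hB₂, ← Submodule.restrictScalars_sup]
    refine (show Ideal.span ((W₁ ⊔ W₂ : Submodule K A) : Set A) ≤ Ideal.span (W₁ : Set A) ⊔
      Ideal.span (W₂ : Set A) from Ideal.span_le.2 ?_)
    intro x hx
    obtain ⟨y, hy, z, hz, rfl⟩ := Submodule.mem_sup.1 hx
    exact Submodule.add_mem_sup (Ideal.subset_span hy) (Ideal.subset_span hz)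
  have hspan' := Submodule.finrank_mono hspan
  have hUle : finrank K U ≤ finrank K (U ⊔ B₁ ⊓ B₂ : Submodule K A) :=
    Submodule.finrank_mono le_sup_left
  have hk : k ≤ t * k := Nat.le_mul_of_pos_left k ht
  have e : (t + 1) * k = t * k + k := by ring
  omega

end FiniteAlgebra

section Chart

open Module

variable {K : Type} [Field K] {n : ℕ} {A : Type} [CommRing A] [Algebra K A]

/-- `φ` is the restriction to an affine chart, the complement of a hyperplane missing the scheme
defined by `I`. -/
structure IsChart (I : Ideal (MvPolynomial (Fin (n + 1)) K))
    (φ : MvPolynomial (Fin (n + 1)) K →ₐ[K] A) : Prop where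
  surjective : Function.Surjective φ
  exists_map_eq_one : ∃ ℓ ∈ homogeneousSubmodule (Fin (n + 1)) K 1, φ ℓ = 1
  map_eq_zero : ∀ f ∈ I, φ f = 0
  mem_of_map_eq_zero : ∀ m, ∀ f ∈ homogeneousSubmodule (Fin (n + 1)) K m, φ f = 0 → f ∈ I

theorem mem_saturate {J : Ideal (MvPolynomial (Fin (n + 1)) K)} {f : MvPolynomial (Fin (n + 1)) K} :
    f ∈ saturate J ↔ ∃ k, ∀ s ∈ irrelevantIdeal K n ^ k, f * s ∈ J := by
  unfold saturate
  rw [Submodule.mem_iSup_of_directed]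
  · simp only [Submodule.mem_colon, smul_eq_mul, SetLike.mem_coe]
  · refine Monotone.directed_le fun a b hab => Submodule.colon_mono le_rfl ?_
    exact Ideal.pow_le_pow_right hab

theorem homogeneousSubmodule_one_le_irrelevantIdeal {f : MvPolynomial (Fin (n + 1)) K}
    (hf : f ∈ homogeneousSubmodule (Fin (n + 1)) K 1) :
    f ∈ irrelevantIdeal K n := by
  rw [homogeneousSubmodule_one_eq_span_X] at hf
  exact Submodule.span_le_restrictScalars K (MvPolynomial (Fin (n + 1)) K) _ hf

theorem irrelevantIdeal_pow_le (k : ℕ) :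
    irrelevantIdeal K n ^ k ≤ Ideal.span (homogeneousSubmodule (Fin (n + 1)) K k :
        Set (MvPolynomial (Fin (n + 1)) K)) := by
  induction k with
  | zero =>
    refine le_of_le_of_eq le_top (Eq.symm ((Ideal.eq_top_iff_one _).2 (Ideal.subset_span ?_)))
    exact isHomogeneous_one _ _
  | succ k ih =>
    rw [pow_succ]
    refine (Ideal.mul_mono_left ih).trans ?_
    rw [irrelevantIdeal, Ideal.span_mul_span']
    refine Ideal.span_mono ?_
    rintro _ ⟨a, ha, _, ⟨i, rfl⟩, rfl⟩
    exact IsHomogeneous.mul ha (isHomogeneous_X K i)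

theorem finrank_map_of_disjoint_ker {M : Type*} [AddCommGroup M] [Module K M] {V : Type*}
    [AddCommGroup V] [Module K V] (f : V →ₗ[K] M) (p : Submodule K V)
    (h : ∀ x ∈ p, f x = 0 → x = 0) : finrank K (p.map f) = finrank K p := by
  rw [← LinearMap.range_domRestrict]
  apply LinearMap.finrank_range_of_inj
  rw [← LinearMap.ker_eq_bot, LinearMap.ker_eq_bot']
  intro x hx
  exact Subtype.ext (h x x.2 hx)

theorem finrank_map_eq_finrank_map {V M N : Type*} [AddCommGroup V] [Module K V] [AddCommGroup M]
    [Module K M] [AddCommGroup N] [Module K N] (f : V →ₗ[K] M) (g : V →ₗ[K] N)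
    (p : Submodule K V) (h : ∀ x ∈ p, f x = 0 ↔ g x = 0) :
    finrank K (p.map f) = finrank K (p.map g) := by
  rw [← LinearMap.range_domRestrict, ← LinearMap.range_domRestrict]
  have hker : LinearMap.ker (f.domRestrict p) = LinearMap.ker (g.domRestrict p) := by
    ext x; exact h x x.2
  rw [← (f.domRestrict p).quotKerEquivRange.finrank_eq,
    ← (g.domRestrict p).quotKerEquivRange.finrank_eq, hker]

theorem finrank_homogeneousSubmodule_one : finrank K (homogeneousSubmodule (Fin (n + 1)) K 1) =
    n + 1 := by
  rw [homogeneousSubmodule_one_eq_span_X, finrank_span_eq_card (linearIndependent_X _ _),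
    Fintype.card_fin]

theorem map_homogeneousSubmodule (φ : MvPolynomial (Fin (n + 1)) K →ₐ[K] A) (m : ℕ) :
    (homogeneousSubmodule (Fin (n + 1)) K m).map φ.toLinearMap =
        (homogeneousSubmodule (Fin (n + 1)) K 1).map φ.toLinearMap ^ m := by
  rw [← Submodule.map_pow, homogeneousSubmodule_one_pow]

theorem schemeDeg_eq {J : Ideal (MvPolynomial (Fin (n + 1)) K)} {c : ℕ}
    (h : ∀ᶠ m in atTop, hilbF J m = c) :
    schemeDeg J = c := by
  have hex : ∃ d : ℕ, ∀ᶠ m : ℕ in atTop, hilbF J m = d := ⟨c, h⟩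
  rw [schemeDeg, dif_pos hex]
  obtain ⟨m, h1, h2⟩ := (hex.choose_spec.and h).exists
  exact h1.symm.trans h2

namespace IsChart

variable {I : Ideal (MvPolynomial (Fin (n + 1)) K)} {φ : MvPolynomial (Fin (n + 1)) K →ₐ[K] A}
    (hφ : IsChart I φ)
include hφ

theorem one_mem : (1 : A) ∈ (homogeneousSubmodule (Fin (n + 1)) K 1).map φ.toLinearMap :=
  let ⟨ℓ, hℓ, h⟩ := hφ.exists_map_eq_one
  ⟨ℓ, hℓ, h⟩

theorem hilbF_eq (m : ℕ) : hilbF I m = finrank K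
    ((homogeneousSubmodule (Fin (n + 1)) K 1).map φ.toLinearMap ^ m : Submodule K A) := by
  rw [hilbF, ← map_homogeneousSubmodule]
  refine finrank_map_eq_finrank_map _ _ _ fun f hf => ?_
  have e : (Ideal.Quotient.mkₐ K I).toLinearMap f = Ideal.Quotient.mk I f := rfl
  rw [e, Ideal.Quotient.eq_zero_iff_mem]
  exact ⟨hφ.map_eq_zero f, hφ.mem_of_map_eq_zero m f hf⟩

theorem exists_pow_eq_top {d : ℕ} (hd : ∀ᶠ m in atTop, hilbF I m = d) :
    ∃ M, (homogeneousSubmodule (Fin (n + 1)) K 1).map φ.toLinearMap ^ M = ⊤ := by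
  obtain ⟨M, hM⟩ := eventually_atTop.1 hd
  have hfg : ((homogeneousSubmodule (Fin (n + 1)) K 1).map φ.toLinearMap).FG := by
    rw [homogeneousSubmodule_one_eq_span_X]
    exact (Submodule.fg_span (Set.finite_range _)).map _
  have hst : ∀ m, M ≤ m →
      (homogeneousSubmodule (Fin (n + 1)) K 1).map φ.toLinearMap ^ m =
          (homogeneousSubmodule (Fin (n + 1)) K 1).map φ.toLinearMap ^ M := by
    intro m hm
    have : FiniteDimensional K ((homogeneousSubmodule (Fin (n + 1)) K 1).map φ.toLinearMap ^ m :
        Submodule K A) :=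
      Module.Finite.iff_fg.2 (hfg.pow m)
    refine (Submodule.eq_of_le_of_finrank_le (pow_mono_of_one_mem hφ.one_mem hm) ?_).symm
    rw [← hφ.hilbF_eq, ← hφ.hilbF_eq, hM m hm, hM M le_rfl]
  refine ⟨M, eq_top_iff.2 fun a _ => ?_⟩
  obtain ⟨f, rfl⟩ := hφ.surjective a
  rw [← sum_homogeneousComponent f, map_sum]
  refine sum_mem fun i _ => ?_
  rw [← hst (max M i) (le_max_left _ _)]
  refine pow_mono_of_one_mem hφ.one_mem (le_max_right M i) ?_
  change _ ∈ (homogeneousSubmodule (Fin (n + 1)) K 1).map φ.toLinearMap ^ i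
  rw [← map_homogeneousSubmodule]
  exact ⟨_, homogeneousComponent_mem i f, rfl⟩

theorem finiteDimensional {d : ℕ} (hd : ∀ᶠ m in atTop, hilbF I m = d) : FiniteDimensional K A := by
  obtain ⟨M, hM⟩ := hφ.exists_pow_eq_top hd
  refine ⟨hM ▸ Submodule.FG.pow ?_ M⟩
  rw [homogeneousSubmodule_one_eq_span_X]
  exact (Submodule.fg_span (Set.finite_range _)).map _

theorem mem_interIdeal {M : ℕ}
    (hM : (homogeneousSubmodule (Fin (n + 1)) K 1).map φ.toLinearMap ^ M = ⊤)
    {W : Submodule K (MvPolynomial (Fin (n + 1)) K)}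
    (hW : W ≤ homogeneousSubmodule (Fin (n + 1)) K 1) {m : ℕ} {f : MvPolynomial (Fin (n + 1)) K}
        (hf : f ∈ homogeneousSubmodule (Fin (n + 1)) K m) :
    f ∈ interIdeal I (Ideal.span (W : Set (MvPolynomial (Fin (n + 1)) K))) ↔
      φ f ∈ Ideal.span (W.map φ.toLinearMap : Set A) := by
  obtain ⟨ℓ, hℓ, hℓ1⟩ := hφ.exists_map_eq_one
  have htop : ∀ m, M ≤ m → (homogeneousSubmodule (Fin (n + 1)) K m).map φ.toLinearMap = ⊤ :=
      fun m hm => by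
    rw [map_homogeneousSubmodule]
    exact top_le_iff.1 (hM ▸ pow_mono_of_one_mem hφ.one_mem hm)
  rw [interIdeal, mem_saturate]
  constructor
  · rintro ⟨k, hk⟩
    obtain ⟨i, hi, w, hw, hiw⟩ := Submodule.mem_sup.1
      (hk (ℓ ^ k) (Ideal.pow_mem_pow (homogeneousSubmodule_one_le_irrelevantIdeal hℓ) k))
    have h := congrArg φ hiw
    rw [map_add, hφ.map_eq_zero i hi, zero_add, map_mul, map_pow, hℓ1, one_pow, mul_one] at h
    rw [← h]
    have hle : Ideal.span (W : Set (MvPolynomial (Fin (n + 1)) K)) ≤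
        (Ideal.span (W.map φ.toLinearMap : Set A)).comap φ :=
      Ideal.span_le.2 fun x hx => Ideal.subset_span ⟨x, hx, rfl⟩
    exact hle hw
  · intro h
    have lift : ∀ b ∈ Ideal.span (W.map φ.toLinearMap : Set A), ∀ a, ∃ g ∈
        homogeneousSubmodule (Fin (n + 1)) K (M + m + 1),
        g ∈ Ideal.span (W : Set (MvPolynomial (Fin (n + 1)) K)) ∧ φ g = a * b := by
      intro b hb
      induction hb using Submodule.span_induction with
      | mem x hx =>
        intro a
        obtain ⟨w, hw, rfl⟩ := hx
        obtain ⟨p, hp, rfl⟩ : a ∈ (homogeneousSubmodule (Fin (n + 1)) K (M + m)).map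
            φ.toLinearMap := by
          rw [htop _ (Nat.le_add_right M m)]; trivial
        exact ⟨p * w, IsHomogeneous.mul hp (hW hw),
          Ideal.mul_mem_left _ _ (Ideal.subset_span hw), map_mul φ p w⟩
      | zero => exact fun a => ⟨0, zero_mem _, zero_mem _, by simp⟩
      | add x y _ _ hx hy =>
        intro a
        obtain ⟨g₁, h₁, h₁', e₁⟩ := hx a
        obtain ⟨g₂, h₂, h₂', e₂⟩ := hy a
        exact ⟨g₁ + g₂, add_mem h₁ h₂, add_mem h₁' h₂', by rw [map_add, e₁, e₂, mul_add]⟩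
      | smul c x _ hx =>
        intro a
        obtain ⟨g, h₁, h₂, e⟩ := hx (a * c)
        exact ⟨g, h₁, h₂, by rw [e, smul_eq_mul, mul_assoc]⟩
    obtain ⟨g, hg, hgW, hgf⟩ := lift _ h 1
    have hmem : ℓ ^ (M + 1) * f ∈ I ⊔ Ideal.span (W : Set (MvPolynomial (Fin (n + 1)) K)) := by
      have h1 : ℓ ^ (M + 1) * f ∈ homogeneousSubmodule (Fin (n + 1)) K (M + m + 1) := by
        have := IsHomogeneous.mul (IsHomogeneous.pow hℓ (M + 1)) hf
        rwa [show 1 * (M + 1) + m = M + m + 1 by ring] at this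
      refine Submodule.mem_sup.2 ⟨ℓ ^ (M + 1) * f - g, ?_, g, hgW, by ring⟩
      refine hφ.mem_of_map_eq_zero _ _ (sub_mem h1 hg) ?_
      rw [map_sub, map_mul, map_pow, hℓ1, hgf]; ring
    refine ⟨M + (M + 1), fun s hs => ?_⟩
    have hs' : s ∈ I ⊔ Ideal.span {ℓ ^ (M + 1)} := by
      refine (irrelevantIdeal_pow_le _).trans (Ideal.span_le.2 fun x hx => ?_) hs
      obtain ⟨y, hy, hyx⟩ : φ x ∈ (homogeneousSubmodule (Fin (n + 1)) K M).map φ.toLinearMap :=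
          by rw [htop _ le_rfl]; trivial
      refine Submodule.mem_sup.2 ⟨x - y * ℓ ^ (M + 1), ?_, y * ℓ ^ (M + 1),
        Ideal.mul_mem_left _ _ (Ideal.mem_span_singleton_self _), by ring⟩
      have h2 := IsHomogeneous.mul hy (IsHomogeneous.pow hℓ (M + 1))
      rw [one_mul] at h2
      refine hφ.mem_of_map_eq_zero _ _ (sub_mem hx h2) ?_
      have hyx' : φ y = φ x := hyx
      rw [map_sub, map_mul, map_pow, hℓ1, hyx']; ring
    obtain ⟨i, hi, z, hz, rfl⟩ := Submodule.mem_sup.1 hs'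
    obtain ⟨c, rfl⟩ := Ideal.mem_span_singleton'.1 hz
    rw [show f * (i + c * ℓ ^ (M + 1)) = f * i + c * (ℓ ^ (M + 1) * f) by ring]
    exact add_mem (Submodule.mem_sup_left (Ideal.mul_mem_left _ _ hi)) (Ideal.mul_mem_left _ _ hmem)

end IsChart

/-- `J` is the ideal of the closed subscheme cut out by the ideal `𝔟` of the chart `φ`. -/
def IsChartIdeal (φ : MvPolynomial (Fin (n + 1)) K →ₐ[K] A)
    (J : Ideal (MvPolynomial (Fin (n + 1)) K)) (𝔟 : Ideal A) : Prop :=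
  ∀ m, ∀ f ∈ homogeneousSubmodule (Fin (n + 1)) K m, f ∈ J ↔ φ f ∈ 𝔟

namespace IsChartIdeal

variable [FiniteDimensional K A] {I J : Ideal (MvPolynomial (Fin (n + 1)) K)}
    {φ : MvPolynomial (Fin (n + 1)) K →ₐ[K] A} {𝔟 : Ideal A}

theorem hilbF_add_finrank (hJ : IsChartIdeal φ J 𝔟) (m : ℕ) :
    hilbF J m + finrank K (𝔟.restrictScalars K) =
      finrank K ((homogeneousSubmodule (Fin (n + 1)) K 1).map φ.toLinearMap ^ m ⊔
          𝔟.restrictScalars K : Submodule K A) := by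
  have h1 : hilbF J m =
      finrank K (((homogeneousSubmodule (Fin (n + 1)) K 1).map φ.toLinearMap ^ m).map
      (𝔟.restrictScalars K).mkQ) := by
    rw [hilbF, ← map_homogeneousSubmodule, ← Submodule.map_comp]
    refine finrank_map_eq_finrank_map _ _ _ fun f hf => ?_
    have e : (Ideal.Quotient.mkₐ K J).toLinearMap f = Ideal.Quotient.mk J f := rfl
    rw [e, Ideal.Quotient.eq_zero_iff_mem, hJ m f hf]
    simp
  have h2 := finrank_map_add_finrank_inf_ker (𝔟.restrictScalars K).mkQ
    ((homogeneousSubmodule (Fin (n + 1)) K 1).map φ.toLinearMap ^ m)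
  rw [Submodule.ker_mkQ] at h2
  have h3 := Submodule.finrank_sup_add_finrank_inf_eq ((homogeneousSubmodule (Fin (n + 1)) K 1).map
      φ.toLinearMap ^ m)
    (𝔟.restrictScalars K)
  omega

theorem schemeDeg_add_finrank (hφ : IsChart I φ) {M : ℕ}
    (hM : (homogeneousSubmodule (Fin (n + 1)) K 1).map φ.toLinearMap ^ M = ⊤)
        (hJ : IsChartIdeal φ J 𝔟) :
    schemeDeg J + finrank K (𝔟.restrictScalars K) = finrank K A := by
  have hle := Submodule.finrank_le (𝔟.restrictScalars K)
  rw [schemeDeg_eq (c := finrank K A - finrank K (𝔟.restrictScalars K))]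
  · omega
  · filter_upwards [eventually_ge_atTop M] with m hm
    have h := hJ.hilbF_add_finrank m
    have htop : (homogeneousSubmodule (Fin (n + 1)) K 1).map φ.toLinearMap ^ m = ⊤ :=
      top_le_iff.1 (hM ▸ pow_mono_of_one_mem hφ.one_mem hm)
    rw [htop, top_sup_eq, finrank_top] at h
    omega

theorem hilbF_eq_schemeDeg_iff (hφ : IsChart I φ) {M : ℕ}
    (hM : (homogeneousSubmodule (Fin (n + 1)) K 1).map φ.toLinearMap ^ M = ⊤)
        (hJ : IsChartIdeal φ J 𝔟) (m : ℕ) :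
    hilbF J m = schemeDeg J ↔ (homogeneousSubmodule (Fin (n + 1)) K 1).map φ.toLinearMap ^ m ⊔
        𝔟.restrictScalars K = ⊤ := by
  have h1 := hJ.hilbF_add_finrank m
  have h2 := hJ.schemeDeg_add_finrank hφ hM
  constructor
  · intro h
    exact eq_top_of_finrank_le (by omega)
  · intro h
    rw [h, finrank_top] at h1
    omega

theorem schemeReg_eq_iff (hφ : IsChart I φ) {M : ℕ}
    (hM : (homogeneousSubmodule (Fin (n + 1)) K 1).map φ.toLinearMap ^ M = ⊤)
        (hJ : IsChartIdeal φ J 𝔟) (k : ℕ) :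
    schemeReg J = k + 2 ↔ (homogeneousSubmodule (Fin (n + 1)) K 1).map φ.toLinearMap ^ (k + 1) ⊔
        𝔟.restrictScalars K = ⊤ ∧
      (homogeneousSubmodule (Fin (n + 1)) K 1).map φ.toLinearMap ^ k ⊔ 𝔟.restrictScalars K ≠ ⊤ := by
  have hset : {p : ℕ | 1 ≤ p ∧ ∀ m : ℕ, p - 1 ≤ m → hilbF J m = schemeDeg J} =
      {p : ℕ | 1 ≤ p ∧ (homogeneousSubmodule (Fin (n + 1)) K 1).map φ.toLinearMap ^ (p - 1) ⊔
          𝔟.restrictScalars K = ⊤} := by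
    ext p
    refine and_congr_right fun _ => ⟨fun h => ?_, fun h m hm => ?_⟩
    · exact (hJ.hilbF_eq_schemeDeg_iff hφ hM _).1 (h _ le_rfl)
    · exact (hJ.hilbF_eq_schemeDeg_iff hφ hM _).2 (pow_sup_eq_top_mono hφ.one_mem hm h)
  rw [schemeReg, hset]
  constructor
  · intro h
    have hne := Nat.nonempty_of_sInf_eq_succ h
    have hmem := Nat.sInf_mem hne
    rw [h] at hmem
    refine ⟨hmem.2, fun hk => ?_⟩
    have := Nat.sInf_le (show k + 1 ∈ {p : ℕ | 1 ≤ p ∧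
      (homogeneousSubmodule (Fin (n + 1)) K 1).map φ.toLinearMap ^ (p - 1) ⊔ 𝔟.restrictScalars K =
          ⊤} from ⟨by omega, hk⟩)
    omega
  · rintro ⟨h1, h2⟩
    refine le_antisymm (Nat.sInf_le ⟨by omega, h1⟩) ?_
    refine le_csInf ⟨k + 2, by omega, h1⟩ fun p hp => ?_
    by_contra! hlt
    exact h2 (pow_sup_eq_top_mono hφ.one_mem (by omega) hp.2)

end IsChartIdeal

/-- Over an infinite field, a saturated ideal admits a linear form that is a nonzerodivisor
modulo it. -/
theorem exists_linear_nonZeroDivisor [Infinite K] {I : Ideal (MvPolynomial (Fin (n + 1)) K)}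
    (hsat : saturate I = I) :
    ∃ ℓ ∈ homogeneousSubmodule (Fin (n + 1)) K 1, ∀ f, ℓ * f ∈ I → f ∈ I := by
  have hfin :
      (associatedPrimes (MvPolynomial (Fin (n + 1)) K) (MvPolynomial (Fin (n + 1)) K ⧸ I)).Finite :=
      associatedPrimes.finite (MvPolynomial (Fin (n + 1)) K) (MvPolynomial (Fin (n + 1)) K ⧸ I)
  let V : Ideal (MvPolynomial (Fin (n + 1)) K) →
      Submodule K (homogeneousSubmodule (Fin (n + 1)) K 1) := fun p =>
      (p.restrictScalars K).comap (homogeneousSubmodule (Fin (n + 1)) K 1).subtype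
  have hunion := biUnion_associatedPrimes_eq_zero_divisors (MvPolynomial (Fin (n + 1)) K)
      (MvPolynomial (Fin (n + 1)) K ⧸ I)
  have htop : ⊤ ∉ hfin.toFinset.image V := by
    intro h
    obtain ⟨p, hp, hpV⟩ := Finset.mem_image.1 h
    obtain ⟨_, x, hx⟩ := (isAssociatedPrime_iff ..).1 (AssociatedPrimes.mem_iff.1
      (hfin.mem_toFinset.1 hp))
    obtain ⟨f, rfl⟩ := Ideal.Quotient.mk_surjective x
    have hS : ∀ s ∈ homogeneousSubmodule (Fin (n + 1)) K 1, s * f ∈ I := by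
      intro s hs
      have h1 : (⟨s, hs⟩ : homogeneousSubmodule (Fin (n + 1)) K 1) ∈ V p := hpV ▸ Submodule.mem_top
      have h2 : s ∈ p := h1
      rw [hx, Submodule.mem_colon_singleton] at h2
      exact Ideal.Quotient.eq_zero_iff_mem.1 h2
    have hf : f ∈ I := by
      rw [← hsat, mem_saturate]
      refine ⟨1, fun s hs => ?_⟩
      rw [pow_one] at hs
      have : irrelevantIdeal K n ≤ Submodule.colon I {f} :=
        Ideal.span_le.2 (by
          rintro _ ⟨i, rfl⟩
          exact Submodule.mem_colon_singleton.2 (hS _ (isHomogeneous_X K i)))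
      have h := Submodule.mem_colon_singleton.1 (this hs)
      rwa [smul_eq_mul, mul_comm] at h
    have hpr : p.IsPrime := (AssociatedPrimes.mem_iff.1 (hfin.mem_toFinset.1 hp)).isPrime
    apply hpr.ne_top
    rw [hx, Ideal.Quotient.eq_zero_iff_mem.2 hf]
    simp
  have hne := Subspace.biUnion_ne_univ_of_top_notMem htop
  obtain ⟨ℓ, hℓ⟩ := (Set.ne_univ_iff_exists_notMem _).1 hne
  refine ⟨ℓ, ℓ.2, fun f hf => ?_⟩
  by_contra hcon
  have hmem : (ℓ : MvPolynomial (Fin (n + 1)) K) ∈ ⋃ p ∈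
      associatedPrimes (MvPolynomial (Fin (n + 1)) K) (MvPolynomial (Fin (n + 1)) K ⧸ I),
      (p : Set (MvPolynomial (Fin (n + 1)) K)) := by
    rw [hunion]
    exact ⟨Ideal.Quotient.mk I f, fun h => hcon (Ideal.Quotient.eq_zero_iff_mem.1 h),
      Ideal.Quotient.eq_zero_iff_mem.2 hf⟩
  simp only [Set.mem_iUnion] at hmem
  obtain ⟨p, hp, hℓp⟩ := hmem
  apply hℓ
  simp only [Set.mem_iUnion]
  exact ⟨V p, Finset.mem_image_of_mem V (hfin.mem_toFinset.2 hp), hℓp⟩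

theorem aeval_mul_of_isHomogeneous (c : A) (x : Fin (n + 1) → A) {m : ℕ}
    {f : MvPolynomial (Fin (n + 1)) K}
    (hf : f ∈ homogeneousSubmodule (Fin (n + 1)) K m) : aeval (fun i => c * x i) f =
        c ^ m * aeval x f := by
  rw [aeval_def, aeval_def, eval₂_eq', eval₂_eq', Finset.mul_sum]
  refine Finset.sum_congr rfl fun d hd => ?_
  have hdeg : ∑ i, d i = m := by
    rw [← Finsupp.degree_eq_sum, Finsupp.degree_eq_weight_one]
    exact hf (mem_support_iff.1 hd)
  simp_rw [mul_pow]
  rw [Finset.prod_mul_distrib, Finset.prod_pow_eq_pow_sum, hdeg]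
  ring

theorem exists_isChart [Infinite K] {I : Ideal (MvPolynomial (Fin (n + 1)) K)}
    (hhom : Ideal.IsHomogeneous (homogeneousSubmodule (Fin (n + 1)) K) I)
    (hsat : saturate I = I) :
    ∃ (A : Type) (_ : CommRing A) (_ : Algebra K A) (φ : MvPolynomial (Fin (n + 1)) K →ₐ[K] A),
        IsChart I φ := by
  obtain ⟨ℓ, hℓ, hnzd⟩ := exists_linear_nonZeroDivisor hsat
  let L := Localization.Away (Ideal.Quotient.mk I ℓ)
  let π : MvPolynomial (Fin (n + 1)) K →ₐ[K] L :=
      (IsScalarTower.toAlgHom K (MvPolynomial (Fin (n + 1)) K ⧸ I) L).comp (Ideal.Quotient.mkₐ K I)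
  let c : L := IsLocalization.Away.invSelf (Ideal.Quotient.mk I ℓ)
  have hc : π ℓ * c = 1 :=
    IsLocalization.Away.mul_invSelf (S := L) (Ideal.Quotient.mk I ℓ)
  have hπ : ∀ f, π f = 0 ↔ f ∈ I := by
    intro f
    rw [← Ideal.Quotient.eq_zero_iff_mem]
    change algebraMap (MvPolynomial (Fin (n + 1)) K ⧸ I) L (Ideal.Quotient.mk I f) = 0 ↔ _
    rw [IsLocalization.map_eq_zero_iff (Submonoid.powers (Ideal.Quotient.mk I ℓ))]
    constructor
    · rintro ⟨⟨_, k, rfl⟩, hk⟩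
      have hk' : ℓ ^ k * f ∈ I := by
        rw [← Ideal.Quotient.eq_zero_iff_mem, map_mul, map_pow]; exact hk
      rw [Ideal.Quotient.eq_zero_iff_mem]
      clear hk
      induction k with
      | zero => simpa using hk'
      | succ k ih => exact ih (hnzd _ (by rwa [← mul_assoc, ← pow_succ']))
    · intro h
      exact ⟨1, by simp [h]⟩
  let θ : MvPolynomial (Fin (n + 1)) K →ₐ[K] L := aeval fun i => c * π (X i)
  have hθ : ∀ m, ∀ f ∈ homogeneousSubmodule (Fin (n + 1)) K m, θ f = c ^ m * π f := by
    intro m f hf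
    have e : π = aeval fun i => π (X i) := by ext i; simp
    conv_rhs => rw [e]
    exact aeval_mul_of_isHomogeneous c _ hf
  have hθ0 : ∀ m, ∀ f ∈ homogeneousSubmodule (Fin (n + 1)) K m, θ f = 0 ↔ f ∈ I := by
    intro m f hf
    have hu : IsUnit (c ^ m) := (IsUnit.of_mul_eq_one_right _ hc).pow m
    rw [hθ m f hf, hu.mul_right_eq_zero, hπ]
  refine ⟨θ.range, inferInstance, inferInstance, θ.rangeRestrict, θ.rangeRestrict_surjective,
    ⟨ℓ, hℓ, Subtype.ext ?_⟩, fun f hf => Subtype.ext ?_, fun m f hf h => ?_⟩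
  · change θ ℓ = 1
    rw [hθ 1 ℓ hℓ, pow_one, mul_comm, hc]
  · change θ f = 0
    rw [← sum_homogeneousComponent f, map_sum]
    refine Finset.sum_eq_zero fun i _ => (hθ0 i _ (homogeneousComponent_mem i f)).2 ?_
    have := hhom i hf
    rwa [← decomposition.decompose'_apply]
  · exact (hθ0 m f hf).1 (congrArg Subtype.val h)

namespace IsChart

variable {I : Ideal (MvPolynomial (Fin (n + 1)) K)} {φ : MvPolynomial (Fin (n + 1)) K →ₐ[K] A}
  (hφ : IsChart I φ)
include hφ

theorem isChartIdeal_bot : IsChartIdeal φ I ⊥ := fun m f hf =>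
  ⟨fun h => Ideal.mem_bot.2 (hφ.map_eq_zero f h), fun h =>
    hφ.mem_of_map_eq_zero m f hf (Ideal.mem_bot.1 h)⟩

theorem isChartIdeal_interIdeal {M : ℕ}
    (hM : (homogeneousSubmodule (Fin (n + 1)) K 1).map φ.toLinearMap ^ M = ⊤)
    {W : Submodule K (MvPolynomial (Fin (n + 1)) K)}
    (hW : W ≤ homogeneousSubmodule (Fin (n + 1)) K 1) :
    IsChartIdeal φ (interIdeal I (Ideal.span (W : Set (MvPolynomial (Fin (n + 1)) K))))
      (Ideal.span (W.map φ.toLinearMap : Set A)) :=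
  fun _ _ hf => hφ.mem_interIdeal hM hW hf

theorem eq_zero_of_map_eq_zero (hnd : NondegenerateScheme I)
    {f : MvPolynomial (Fin (n + 1)) K} (hf : f ∈ homogeneousSubmodule (Fin (n + 1)) K 1)
    (h : φ f = 0) : f = 0 := by
  have : f ∈ I.restrictScalars K ⊓ homogeneousSubmodule (Fin (n + 1)) K 1 :=
    ⟨hφ.mem_of_map_eq_zero 1 f hf h, hf⟩
  rw [hnd] at this
  exact this

theorem finrank_map (hnd : NondegenerateScheme I)
    {W : Submodule K (MvPolynomial (Fin (n + 1)) K)}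
    (hW : W ≤ homogeneousSubmodule (Fin (n + 1)) K 1) :
    finrank K (W.map φ.toLinearMap) = finrank K W :=
  finrank_map_of_disjoint_ker _ _ fun _ hx => hφ.eq_zero_of_map_eq_zero hnd (hW hx)

theorem eq_of_map_eq (hnd : NondegenerateScheme I)
    {W₁ W₂ : Submodule K (MvPolynomial (Fin (n + 1)) K)}
    (h₁ : W₁ ≤ homogeneousSubmodule (Fin (n + 1)) K 1)
    (h₂ : W₂ ≤ homogeneousSubmodule (Fin (n + 1)) K 1)
    (h : W₁.map φ.toLinearMap = W₂.map φ.toLinearMap) : W₁ = W₂ := by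
  have key : ∀ {V₁ V₂ : Submodule K (MvPolynomial (Fin (n + 1)) K)},
      V₁ ≤ homogeneousSubmodule (Fin (n + 1)) K 1 → V₂ ≤ homogeneousSubmodule (Fin (n + 1)) K 1 →
      V₁.map φ.toLinearMap ≤ V₂.map φ.toLinearMap → V₁ ≤ V₂ := by
    intro V₁ V₂ h₁ h₂ h x hx
    obtain ⟨y, hy, hyx⟩ := h (Submodule.mem_map_of_mem hx)
    have hyx' : φ (x - y) = 0 := by rw [map_sub, sub_eq_zero]; exact hyx.symm
    rwa [sub_eq_zero.1 (hφ.eq_zero_of_map_eq_zero hnd (sub_mem (h₁ hx) (h₂ hy)) hyx')]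
  exact le_antisymm (key h₁ h₂ h.le) (key h₂ h₁ h.ge)

omit hφ in
theorem exists_map_eq {W' : Submodule K A}
    (h : W' ≤ (homogeneousSubmodule (Fin (n + 1)) K 1).map φ.toLinearMap) :
    ∃ W ≤ homogeneousSubmodule (Fin (n + 1)) K 1, W.map φ.toLinearMap = W' :=
  by
  refine ⟨homogeneousSubmodule (Fin (n + 1)) K 1 ⊓ W'.comap φ.toLinearMap, inf_le_left,
    le_antisymm (Submodule.map_le_iff_le_comap.2 inf_le_right) fun x hx => ?_⟩
  obtain ⟨f, hf, rfl⟩ := h hx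
  exact ⟨f, ⟨hf, hx⟩, rfl⟩

theorem secantFree_tInv [FiniteDimensional K A] (hnd : NondegenerateScheme I) {M : ℕ}
    (hM : (homogeneousSubmodule (Fin (n + 1)) K 1).map φ.toLinearMap ^ M = ⊤) :
    SecantFree ((homogeneousSubmodule (Fin (n + 1)) K 1).map φ.toLinearMap) (tInv I) := by
  intro W' hW' hcodim
  have hU : finrank K ((homogeneousSubmodule (Fin (n + 1)) K 1).map φ.toLinearMap) = n + 1 :=
    (hφ.finrank_map hnd le_rfl).trans finrank_homogeneousSubmodule_one
  have hle := Submodule.finrank_mono hW'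
  rcases hle.eq_or_lt with heq | hlt
  · have hone : (1 : A) ∈ W' := Submodule.eq_of_le_of_finrank_eq hW' heq ▸ hφ.one_mem
    rw [(Ideal.eq_top_iff_one _).2 (Ideal.subset_span hone), Submodule.restrictScalars_top,
      finrank_top, heq]
  · obtain ⟨W, hW, rfl⟩ := exists_map_eq hW'
    have hdim := hφ.finrank_map hnd hW
    have hs : n - finrank K W < tInv I := by omega
    have hnot : ¬ HasSecantPlane I (n - finrank K W) := Nat.notMem_of_lt_sInf hs
    have hdeg := (hφ.isChartIdeal_interIdeal hM hW).schemeDeg_add_finrank hφ hM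
    by_contra! hcon
    exact hnot ⟨_, ⟨W, hW, by omega, rfl⟩, by omega⟩

end IsChart

end Chart

theorem le_of_ceil_div_add_le {a : ℤ} {t k : ℕ}
    (h : ⌈(a : ℚ) / ((t : ℚ) + 1)⌉ ≤ (k : ℤ)) : a ≤ (t + 1) * k := by
  have h1 := Int.ceil_le.1 h
  rw [div_le_iff₀ (by positivity)] at h1
  have h2 : (a : ℚ) ≤ (((t + 1) * k : ℤ) : ℚ) := by push_cast at h1 ⊢; linarith
  exact_mod_cast h2

/-- Theorem 1.1. -/
theorem stmt0 (K : Type) [Field K] [IsAlgClosed K] [CharZero K] (n d : ℕ)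
    (I : Ideal (MvPolynomial (Fin (n+1)) K))
    (hfin : IsFiniteSubscheme I) (hnd : NondegenerateScheme I)
    (hdeg : schemeDeg I = d)
    (hlow : ⌈((d : ℚ) - n - 1) / ((tInv I : ℚ) + 1)⌉ + 3 ≤ (schemeReg I : ℤ))
    (hhigh : (schemeReg I : ℤ) ≤ ⌈((d : ℚ) - n - 1) / (tInv I : ℚ)⌉ + 2) :
    ∃! Λ : Ideal (MvPolynomial (Fin (n+1)) K),
      IsLinearSubspace Λ (tInv I) ∧
      NondegenerateIn I Λ (tInv I) ∧
      InLinGenPosIn I Λ (tInv I) ∧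
      schemeReg (interIdeal I Λ) = schemeReg I := by
  have : Infinite K := IsAlgClosed.instInfinite
  obtain ⟨A, _, _, φ, hφ⟩ := exists_isChart hfin.homog hfin.saturated
  obtain ⟨d', -, hd'⟩ := hfin.finite
  have : FiniteDimensional K A := hφ.finiteDimensional hd'
  obtain ⟨M, hM⟩ := hφ.exists_pow_eq_top hd'
  have hS := hφ.secantFree_tInv hnd hM
  have hone := hφ.one_mem
  have hdimU : Module.finrank K
      ((homogeneousSubmodule (Fin (n + 1)) K 1).map φ.toLinearMap) = n + 1 :=
    (hφ.finrank_map hnd le_rfl).trans finrank_homogeneousSubmodule_one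
  have hregI := hφ.isChartIdeal_bot.schemeReg_eq_iff hφ hM
  have hregW := fun (W : Submodule K (MvPolynomial (Fin (n + 1)) K))
    (hW : W ≤ homogeneousSubmodule (Fin (n + 1)) K 1) =>
    (hφ.isChartIdeal_interIdeal hM hW).schemeReg_eq_iff hφ hM
  have hdegA : d = Module.finrank K A := by
    have h := hφ.isChartIdeal_bot.schemeDeg_add_finrank hφ hM
    have h0 : Module.finrank K ((⊥ : Ideal A).restrictScalars K) = 0 := by
      rw [Submodule.restrictScalars_bot, finrank_bot]
    omega
  have hdn : n + 1 ≤ d := by rw [hdegA, ← hdimU]; exact Submodule.finrank_le _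
  set U := (homogeneousSubmodule (Fin (n + 1)) K 1).map φ.toLinearMap with hUdef
  have hcast : (d : ℚ) - n - 1 = (((d : ℤ) - n - 1 : ℤ) : ℚ) := by push_cast; ring
  have hceil : 0 ≤ ⌈((d : ℚ) - n - 1) / ((tInv I : ℚ) + 1)⌉ := by
    refine Int.ceil_nonneg (div_nonneg ?_ (by positivity))
    rw [hcast]
    exact_mod_cast (by omega : (0 : ℤ) ≤ (d : ℤ) - n - 1)
  obtain ⟨k, hk⟩ : ∃ k, schemeReg I = k + 1 + 2 := ⟨schemeReg I - 3, by omega⟩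
  have ht : 1 ≤ tInv I := by
    by_contra! h0
    rw [Nat.lt_one_iff.1 h0, Nat.cast_zero, div_zero, Int.ceil_zero] at hhigh
    omega
  have hbound : d ≤ n + 1 + (tInv I + 1) * k := by
    rw [hcast] at hlow
    have h := le_of_ceil_div_add_le (a := (d : ℤ) - n - 1) (t := tInv I) (k := k) (by omega)
    zify; linarith
  have hmin : ∀ s < tInv I, ¬ HasSecantPlane I s := fun s hs => Nat.notMem_of_lt_sInf hs
  clear hlow hhigh hceil
  generalize tInv I = t at *
  obtain ⟨htop, hne⟩ := (hregI (k + 1)).1 hk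
  rw [hk]
  have hreg : ∀ W ≤ homogeneousSubmodule (Fin (n + 1)) K 1,
      (schemeReg (interIdeal I (Ideal.span (W : Set (MvPolynomial (Fin (n + 1)) K)))) =
        k + 1 + 2 ↔
      U ^ (k + 1) ⊔ (Ideal.span (W.map φ.toLinearMap : Set A)).restrictScalars K ≠ ⊤) :=
    fun W hW => (hregW W hW (k + 1)).trans
      (and_iff_right (sup_eq_top_of_le htop bot_le))
  obtain ⟨W', hW'U, hcodim, hneW⟩ := hS.exists_pow_sup_ne_top hone ht k ⊥
    (by rw [Submodule.restrictScalars_bot, sup_bot_eq, hdimU, ← hdegA]; exact hbound) hne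
  rw [bot_sup_eq] at hneW
  obtain ⟨W, hW, rfl⟩ := IsChart.exists_map_eq hW'U
  have hdimW := hφ.finrank_map hnd hW
  refine ⟨Ideal.span (W : Set (MvPolynomial (Fin (n + 1)) K)),
    ⟨⟨W, hW, by omega, rfl⟩, ?_, ?_, (hreg W hW).2 hneW⟩, ?_⟩
  · rintro _ ⟨V, hV, hdimV, rfl⟩ - hle
    have hVle : V.map φ.toLinearMap ≤
        U ⊓ (Ideal.span (W.map φ.toLinearMap : Set A)).restrictScalars K := by
      rintro _ ⟨f, hf, rfl⟩
      exact ⟨Submodule.mem_map_of_mem (hV hf),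
        (hφ.mem_interIdeal hM hW (hV hf)).1 (hle (Ideal.subset_span hf))⟩
    have h1 := Submodule.finrank_mono hVle
    rw [hφ.finrank_map hnd hV] at h1
    have h2 := hS.sup_eq_top (𝔞 := Ideal.span (W.map φ.toLinearMap : Set A)) (by omega)
    exact hneW (pow_sup_eq_top_mono hone (Nat.le_add_left 1 k) (by rwa [pow_one]))
  · intro s hs J hJ _
    by_contra! hcon
    exact hmin s hs ⟨J, hJ, hcon⟩
  · rintro _ ⟨⟨V, hV, hdimV, rfl⟩, -, -, hregV⟩
    have hdimV' := hφ.finrank_map hnd hV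
    rw [hφ.eq_of_map_eq hnd hV hW (hS.eq_of_pow_sup_ne_top hone ht
      (by rw [hdimU, ← hdegA]; exact hbound) (Submodule.map_mono hV) hW'U (by omega)
      hcodim ((hreg V hV).1 hregV) hneW)]
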